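/- arXiv:2503.03551 — 2 statements merged into one kernel-verified Lean document; each statement's English description precedes it below -/
import Mathlib

section
/- Let T be a compact bridge from (A,ρ) to (B,σ), let L = pr_{1,2}(T), R = pr_{3,4}(T), α = Opt(ρ,L), and β = Opt(σ,R). Then tr(T) induces an isomorphism γ : A/α ≅ B/β, defined by γ(a/α) = b/β if and only if (a,b) ∈ α ∘ tr(T) ∘ β. -/
namespace Zhuk

/-- A signature: a type of operation symbols with arities. -/
structure Signature where
  ops : Type
  arity : ops → ℕ

/-- An algebra structure of signature `S` on carrier `A`. -/
class SAlg (S : Signature) (A : Type) where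
  interp : (o : S.ops) → (Fin (S.arity o) → A) → A

variable {S : Signature}

/-- Componentwise algebra structure on a product. -/
instance prodSAlg {A B : Type} [SAlg S A] [SAlg S B] : SAlg S (A × B) :=
  ⟨fun o x => (SAlg.interp o fun i => (x i).1, SAlg.interp o fun i => (x i).2)⟩

/-- A subset closed under all the operations. -/
def IsSubuniverse (S : Signature) {A : Type} [SAlg S A] (R : Set A) : Prop :=
  ∀ (o : S.ops) (x : Fin (S.arity o) → A), (∀ i, x i ∈ R) → SAlg.interp o x ∈ R

/-- The algebra structure on (the subtype of) a subuniverse. -/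
def subAlg {A : Type} [SAlg S A] (R : Set A) (h : IsSubuniverse S R) : SAlg S ↥R :=
  ⟨fun o x => ⟨SAlg.interp o fun i => (x i).1, h o _ fun i => (x i).2⟩⟩

/-- Terms of signature `S` in `n` variables. -/
inductive STerm (S : Signature) (n : ℕ) : Type
  | var : Fin n → STerm S n
  | app (o : S.ops) : (Fin (S.arity o) → STerm S n) → STerm S n

/-- Evaluation of a term in an algebra. -/
def STerm.eval {A : Type} [SAlg S A] {n : ℕ} : STerm S n → (Fin n → A) → A
  | .var i, v => v i
  | .app o ts, v => SAlg.interp o fun i => (ts i).eval v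

/-- The diagonal (smallest) congruence `0_A`. -/
def diag (A : Type) : Set (A × A) := {p | p.1 = p.2}

/-- Relational composition. -/
def rcomp {A B C : Type} (R : Set (A × B)) (T : Set (B × C)) : Set (A × C) :=
  {p | ∃ b, (p.1, b) ∈ R ∧ (b, p.2) ∈ T}

/-- Relational inverse. -/
def rinv {A B : Type} (R : Set (A × B)) : Set (B × A) := {p | (p.2, p.1) ∈ R}

/-- Transitive closure of a binary relation (as a set of pairs). -/
def transCl {A : Type} (R : Set (A × A)) : Set (A × A) :=
  {p | Relation.TransGen (fun a b => (a, b) ∈ R) p.1 p.2}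

/-- `R` is stable under (saturated with respect to) `ρ`:  `R = ρ ∘ R ∘ ρ`. -/
def Saturated {A : Type} (ρ R : Set (A × A)) : Prop := rcomp ρ (rcomp R ρ) = R

/-- A congruence: a subuniverse of `A²` which is an equivalence relation. -/
def IsCongruence (S : Signature) {A : Type} [SAlg S A] (θ : Set (A × A)) : Prop :=
  IsSubuniverse S θ ∧ Equivalence fun a b => (a, b) ∈ θ

/-- `ρ ∈ Con*(A)`: a congruence different from the full congruence `1_A`. -/
def ConStar (S : Signature) {A : Type} [SAlg S A] (ρ : Set (A × A)) : Prop :=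
  IsCongruence S ρ ∧ ρ ≠ Set.univ

/-- The ternary centralizer relation `C(φ, θ; δ)`, via the term condition. -/
def Centralizes (S : Signature) {A : Type} [SAlg S A] (φ θ δ : Set (A × A)) : Prop :=
  ∀ (n : ℕ) (t : STerm S (n + 1)) (a b : A) (c d : Fin n → A),
    (a, b) ∈ φ → (∀ i, (c i, d i) ∈ θ) →
    (t.eval (Fin.cons a c), t.eval (Fin.cons a d)) ∈ δ →
    (t.eval (Fin.cons b c), t.eval (Fin.cons b d)) ∈ δ

/-- The centralizer `(δ : θ)`: the largest congruence `φ` with `C(φ, θ; δ)`. -/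
def centralizer (S : Signature) {A : Type} [SAlg S A] (δ θ : Set (A × A)) : Set (A × A) :=
  ⋃₀ {φ | IsCongruence S φ ∧ Centralizes S φ θ δ}

/-- A congruence of the subalgebra `A(θ) ≤ A²`, viewed ambiently as a subset of
`(A×A) × (A×A)` whose field is `θ`. -/
def IsConOn (S : Signature) {A : Type} [SAlg S A] (θ : Set (A × A))
    (Δ : Set ((A × A) × (A × A))) : Prop :=
  Δ ⊆ θ ×ˢ θ ∧ IsSubuniverse S Δ ∧ (∀ p ∈ θ, (p, p) ∈ Δ) ∧
    (∀ p q, (p, q) ∈ Δ → (q, p) ∈ Δ) ∧ (∀ p q r, (p, q) ∈ Δ → (q, r) ∈ Δ → (p, r) ∈ Δ)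

/-- `Δ_{θ,α}`: the congruence of `A(θ)` generated by `{((a,a),(b,b)) : (a,b) ∈ α}`. -/
def DeltaCon (S : Signature) {A : Type} [SAlg S A] (θ α : Set (A × A)) :
    Set ((A × A) × (A × A)) :=
  ⋂₀ {Δ | IsConOn S θ Δ ∧ ∀ a b : A, (a, b) ∈ α → ((a, a), (b, b)) ∈ Δ}

/-- Projection of a quaternary relation to its first two coordinates. -/
def pr12 {A B : Type} (T : Set (A × A × B × B)) : Set (A × A) :=
  {p | ∃ b₁ b₂, (p.1, p.2, b₁, b₂) ∈ T}

/-- Projection of a quaternary relation to its last two coordinates. -/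
def pr34 {A B : Type} (T : Set (A × A × B × B)) : Set (B × B) :=
  {q | ∃ a₁ a₂, (a₁, a₂, q.1, q.2) ∈ T}

/-- The trace of a quaternary relation. -/
def btr {A B : Type} (T : Set (A × A × B × B)) : Set (A × B) :=
  {p | (p.1, p.1, p.2, p.2) ∈ T}

/-- Zhuk's bridges: Definition 4.3 (B0*), (B1*), (B2*). -/
def IsBridge (S : Signature) {A B : Type} [SAlg S A] [SAlg S B]
    (ρ : Set (A × A)) (σ : Set (B × B)) (T : Set (A × A × B × B)) : Prop :=
  IsSubuniverse S T ∧
  (∀ a₁ a₂ b₁ b₂ a₁' a₂', (a₁, a₂, b₁, b₂) ∈ T → (a₁, a₁') ∈ ρ → (a₂, a₂') ∈ ρ →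
    (a₁', a₂', b₁, b₂) ∈ T) ∧
  (∀ a₁ a₂ b₁ b₂ b₁' b₂', (a₁, a₂, b₁, b₂) ∈ T → (b₁, b₁') ∈ σ → (b₂, b₂') ∈ σ →
    (a₁, a₂, b₁', b₂') ∈ T) ∧
  ρ ⊂ pr12 T ∧ σ ⊂ pr34 T ∧
  (∀ a₁ a₂ b₁ b₂, (a₁, a₂, b₁, b₂) ∈ T → ((a₁, a₂) ∈ ρ ↔ (b₁, b₂) ∈ σ))

/-- A bridge from `(A,ρ,L)` to `(B,σ,R)`: a bridge with prescribed anchors. -/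
def IsBridgeLR (S : Signature) {A B : Type} [SAlg S A] [SAlg S B]
    (ρ : Set (A × A)) (σ : Set (B × B)) (L : Set (A × A)) (R : Set (B × B))
    (T : Set (A × A × B × B)) : Prop :=
  IsBridge S ρ σ T ∧ pr12 T = L ∧ pr34 T = R

/-- A reflexive bridge (case `B = A`): `0_A ⊆ tr(T)`. -/
def ReflBridge {A : Type} (T : Set (A × A × A × A)) : Prop :=
  ∀ a : A, (a, a) ∈ btr T

/-- `Cov(ρ)`: the inclusion-minimal ρ-saturated subuniverses of `A²` properly containing ρ. -/
def Cov (S : Signature) {A : Type} [SAlg S A] (ρ : Set (A × A)) : Set (Set (A × A)) :=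
  {L | IsSubuniverse S L ∧ Saturated ρ L ∧ ρ ⊂ L ∧
    ∀ L', IsSubuniverse S L' → Saturated ρ L' → ρ ⊂ L' → L' ⊆ L → L' = L}

/-- `ref.tr(ρ,L)`: traces of reflexive bridges from `(A,ρ,L)` to itself. -/
def refTr (S : Signature) {A : Type} [SAlg S A] (ρ L : Set (A × A)) : Set (Set (A × A)) :=
  {γ | ∃ T : Set (A × A × A × A), IsBridgeLR S ρ ρ L L T ∧ ReflBridge T ∧ btr T = γ}

/-- `γ = Opt(ρ,L)`: `γ` is the (unique) inclusion-maximal member of `ref.tr(ρ,L)`. -/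
def IsOptOf (S : Signature) {A : Type} [SAlg S A] (ρ L γ : Set (A × A)) : Prop :=
  γ ∈ refTr S ρ L ∧ ∀ δ ∈ refTr S ρ L, γ ⊆ δ → δ = γ

/-- `ρ` is meet-irreducible with unique upper cover `ρplus`. -/
def MeetIrredWith (S : Signature) {A : Type} [SAlg S A] (ρ ρplus : Set (A × A)) : Prop :=
  IsCongruence S ρ ∧ ρ ≠ Set.univ ∧ IsCongruence S ρplus ∧ ρ ⊂ ρplus ∧
    ∀ θ, IsCongruence S θ → ρ ⊂ θ → ρplus ⊆ θ

/-- `Cov⁺(ρ) = {τ ∈ Cov(ρ) : τ ⊆ ρ⁺}`. -/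
def CovPlus (S : Signature) {A : Type} [SAlg S A] (ρ ρplus : Set (A × A)) :
    Set (Set (A × A)) :=
  {τ | τ ∈ Cov S ρ ∧ τ ⊆ ρplus}

/-- A good bridge between meet-irreducible congruences with upper covers `ρplus`, `σplus`. -/
def GoodBridge (S : Signature) {A B : Type} [SAlg S A] [SAlg S B]
    (ρ ρplus : Set (A × A)) (σ σplus : Set (B × B)) (T : Set (A × A × B × B)) : Prop :=
  IsBridge S ρ σ T ∧
    ∃ τ ∈ CovPlus S ρ ρplus, ∃ τ' ∈ CovPlus S σ σplus, ∃ T' ⊆ T,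
      IsBridgeLR S ρ σ τ τ' T' ∧ btr T' = btr T

/-- `t` (with Taylor-identity data `u v`) is idempotent on `A` and satisfies the
corresponding identities on `A`. -/
def TaylorOn (S : Signature) (A : Type) [SAlg S A] {n : ℕ} (t : STerm S n)
    (u v : Fin n → Fin n → Fin 2) : Prop :=
  (∀ a : A, t.eval (fun _ => a) = a) ∧
    ∀ (i : Fin n) (x y : A),
      t.eval (fun j => if u i j = 0 then x else y) =
        t.eval (fun j => if v i j = 0 then x else y)

/-- `A` is a Taylor algebra. -/
def IsTaylorAlg (S : Signature) (A : Type) [SAlg S A] : Prop :=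
  ∃ (n : ℕ) (t : STerm S n) (u v : Fin n → Fin n → Fin 2),
    1 < n ∧ (∀ i, u i i ≠ v i i) ∧ TaylorOn S A t u v

/-- `A` and `B` lie in a common (locally finite, as they are finite) Taylor variety:
they share a common Taylor term with common Taylor identities. -/
def CommonTaylor (S : Signature) (A B : Type) [SAlg S A] [SAlg S B] : Prop :=
  ∃ (n : ℕ) (t : STerm S n) (u v : Fin n → Fin n → Fin 2),
    1 < n ∧ (∀ i, u i i ≠ v i i) ∧ TaylorOn S A t u v ∧ TaylorOn S B t u v

/-- The quotient of `A` by (the equivalence relation of) `θ`. -/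
abbrev ConQuot {A : Type} (θ : Set (A × A)) : Type :=
  Quot (fun a b => (a, b) ∈ θ)

/-- The class of `a` in `A/θ`. -/
def ConQuot.mk {A : Type} (θ : Set (A × A)) (a : A) : ConQuot θ :=
  Quot.mk _ a

/-- The quotient algebra structure on `A/θ` (extensionally correct when `θ` is a
congruence). -/
noncomputable def quotAlg {S : Signature} {A : Type} (iA : SAlg S A) (θ : Set (A × A)) :
    SAlg S (ConQuot θ) :=
  ⟨fun o x => ConQuot.mk θ
    (@SAlg.interp S A iA o fun i => Classical.choose (Quot.exists_rep (x i)))⟩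

/-- `f` is a homomorphism with respect to the given algebra structures. -/
def IsHomI {S : Signature} {A B : Type} (iA : SAlg S A) (iB : SAlg S B) (f : A → B) : Prop :=
  ∀ (o : S.ops) (x : Fin (S.arity o) → A),
    f (@SAlg.interp S A iA o x) = @SAlg.interp S B iB o fun i => f (x i)

/-- The two algebras are isomorphic. -/
def IsoAlgI {S : Signature} {A B : Type} (iA : SAlg S A) (iB : SAlg S B) : Prop :=
  ∃ f : A ≃ B, IsHomI iA iB f

/-- The identity bridge `I_{(A,ρ,L)}`. -/
def idBridge {A : Type} (ρ L : Set (A × A)) : Set (A × A × A × A) :=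
  {p | (p.1, p.2.1) ∈ L ∧ (p.2.2.1, p.2.2.2) ∈ L ∧ (p.1, p.2.2.1) ∈ ρ ∧ (p.2.1, p.2.2.2) ∈ ρ}

/-- Composition of quaternary relations (bridges). -/
def bComp {A B C : Type} (T : Set (A × A × B × B)) (T' : Set (B × B × C × C)) :
    Set (A × A × C × C) :=
  {p | ∃ b₁ b₂, (p.1, p.2.1, b₁, b₂) ∈ T ∧ (b₁, b₂, p.2.2.1, p.2.2.2) ∈ T'}

/-- Converse of a quaternary relation (bridge). -/
def bConv {A B : Type} (T : Set (A × A × B × B)) : Set (B × B × A × A) :=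
  {p | (p.2.2.1, p.2.2.2, p.1, p.2.1) ∈ T}

/-- `Δ♭_{θ,α}`: the congruence `Δ_{θ,α}` of `A(θ)` viewed as a quaternary relation. -/
def deltaFlat (S : Signature) {A : Type} [SAlg S A] (θ α : Set (A × A)) :
    Set (A × A × A × A) :=
  {p | ((p.1, p.2.1), (p.2.2.1, p.2.2.2)) ∈ DeltaCon S θ α}

/-- `T^opt_{(A,ρ)} = I_{(A,ρ,ρ⁺)} ∘ Δ♭_{ρ⁺,(ρ:ρ⁺)} ∘ I_{(A,ρ,ρ⁺)}`. -/
def Topt (S : Signature) {A : Type} [SAlg S A] (ρ ρplus : Set (A × A)) :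
    Set (A × A × A × A) :=
  bComp (idBridge ρ ρplus)
    (bComp (deltaFlat S ρplus (centralizer S ρ ρplus)) (idBridge ρ ρplus))

/-- `A` is subdirectly irreducible with monolith `μ`. -/
def IsMonolith (S : Signature) {A : Type} [SAlg S A] (μ : Set (A × A)) : Prop :=
  IsCongruence S μ ∧ μ ≠ diag A ∧ ∀ θ, IsCongruence S θ → θ ≠ diag A → μ ⊆ θ

/-- The carrier of `D(A,θ)`-style quotients: `A(μ)/Δ_{μ,α}`. -/
abbrev DCar (S : Signature) (A : Type) [SAlg S A] (μ α : Set (A × A)) : Type :=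
  Quot (fun p q : ↥μ => ((p : A × A), (q : A × A)) ∈ DeltaCon S μ α)

/-- The class of a pair `p ∈ μ` in `A(μ)/Δ_{μ,α}`. -/
def DCar.mk (S : Signature) (A : Type) [SAlg S A] (μ α : Set (A × A)) (p : ↥μ) :
    DCar S A μ α :=
  Quot.mk _ p

/-- The algebra structure on `A(μ)/Δ_{μ,α}` (extensionally correct when `μ` is a
congruence and `Δ_{μ,α}` is a congruence of `A(μ)`). -/
noncomputable def DAlg (S : Signature) (A : Type) [SAlg S A] (μ α : Set (A × A))
    (h : IsSubuniverse S μ) : SAlg S (DCar S A μ α) :=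
  letI := subAlg μ h
  ⟨fun o x => DCar.mk S A μ α
    (SAlg.interp o fun i => Classical.choose (Quot.exists_rep (x i)))⟩

/-- The canonical similarity bridge `T_{D(A)}` from `A` to `D(A)`. -/
def TDBridge (S : Signature) (A : Type) [SAlg S A] (μ α : Set (A × A)) :
    Set (A × A × DCar S A μ α × DCar S A μ α) :=
  {x | ∃ (a b e : A) (_ : (a, b) ∈ μ) (h1 : (a, e) ∈ μ) (h2 : (b, e) ∈ μ),
    x = (a, b, DCar.mk S A μ α ⟨(a, e), h1⟩, DCar.mk S A μ α ⟨(b, e), h2⟩)}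

/-- Similarity of (subdirectly irreducible) algebras: `D(A) ≅ D(B)`, where `D(X)` is
`X(μ)/Δ_{μ,(0:μ)}` if the monolith `μ` is abelian, and `X` itself otherwise. -/
def SimilarI (S : Signature) {A B : Type} (iA : SAlg S A) (iB : SAlg S B) : Prop :=
  letI := iA
  letI := iB
  ∃ (μA : Set (A × A)) (μB : Set (B × B)) (hA : IsMonolith S μA) (hB : IsMonolith S μB),
    ((Centralizes S μA μA (diag A) ∧ Centralizes S μB μB (diag B)) →
      IsoAlgI (DAlg S A μA (centralizer S (diag A) μA) hA.1.1)
        (DAlg S B μB (centralizer S (diag B) μB) hB.1.1)) ∧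
    ((Centralizes S μA μA (diag A) ∧ ¬ Centralizes S μB μB (diag B)) →
      IsoAlgI (DAlg S A μA (centralizer S (diag A) μA) hA.1.1) iB) ∧
    ((¬ Centralizes S μA μA (diag A) ∧ Centralizes S μB μB (diag B)) →
      IsoAlgI iA (DAlg S B μB (centralizer S (diag B) μB) hB.1.1)) ∧
    ((¬ Centralizes S μA μA (diag A) ∧ ¬ Centralizes S μB μB (diag B)) →
      IsoAlgI iA iB)

end Zhuk

namespace Zhuk

theorem IsSubuniverse.rcomp {S : Signature} {A B C : Type} [SAlg S A] [SAlg S B] [SAlg S C]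
    {R : Set (A × B)} {T : Set (B × C)} (hR : IsSubuniverse S R) (hT : IsSubuniverse S T) :
    IsSubuniverse S (rcomp R T) := by
  intro o x hx
  choose b hb hb' using hx
  exact ⟨SAlg.interp o b, hR o (fun i => ((x i).1, b i)) hb, hT o (fun i => (b i, (x i).2)) hb'⟩

theorem IsSubuniverse.bComp {S : Signature} {A B C : Type} [SAlg S A] [SAlg S B] [SAlg S C]
    {T : Set (A × A × B × B)} {U : Set (B × B × C × C)}
    (hT : IsSubuniverse S T) (hU : IsSubuniverse S U) : IsSubuniverse S (bComp T U) := by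
  intro o x hx
  choose b₁ b₂ hb hb' using hx
  exact ⟨SAlg.interp o b₁, SAlg.interp o b₂,
    hT o (fun i => ((x i).1, (x i).2.1, b₁ i, b₂ i)) hb,
    hU o (fun i => (b₁ i, b₂ i, (x i).2.2.1, (x i).2.2.2)) hb'⟩

theorem IsSubuniverse.bConv {S : Signature} {A B : Type} [SAlg S A] [SAlg S B]
    {T : Set (A × A × B × B)} (hT : IsSubuniverse S T) : IsSubuniverse S (bConv T) :=
  fun o x hx => hT o (fun i => ((x i).2.2.1, (x i).2.2.2, (x i).1, (x i).2.1)) hx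

theorem IsSubuniverse.btr {S : Signature} {A B : Type} [SAlg S A] [SAlg S B]
    {T : Set (A × A × B × B)} (hT : IsSubuniverse S T) : IsSubuniverse S (btr T) :=
  fun o x hx => hT o (fun i => ((x i).1, (x i).1, (x i).2, (x i).2)) hx

section Bridge

variable {S : Signature} {A B C : Type} [SAlg S A] [SAlg S B] [SAlg S C]
  {ρ L : Set (A × A)} {σ R : Set (B × B)} {τ Q : Set (C × C)}
  {T : Set (A × A × B × B)} {U : Set (B × B × C × C)}

theorem IsBridgeLR.conv (hT : IsBridgeLR S ρ σ L R T) : IsBridgeLR S σ ρ R L (bConv T) := by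
  obtain ⟨⟨h0, h1, h2, h3, h4, h5⟩, hL, hR⟩ := hT
  exact ⟨⟨h0.bConv, fun _ _ _ _ _ _ h => h2 _ _ _ _ _ _ h, fun _ _ _ _ _ _ h => h1 _ _ _ _ _ _ h,
    h4, h3, fun _ _ _ _ h => (h5 _ _ _ _ h).symm⟩, hR, hL⟩

theorem IsBridgeLR.comp (hT : IsBridgeLR S ρ σ L R T) (hU : IsBridgeLR S σ τ R Q U) :
    IsBridgeLR S ρ τ L Q (bComp T U) := by
  obtain ⟨⟨h0, h1, h2, h3, h4, h5⟩, rfl, rfl⟩ := hT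
  obtain ⟨⟨k0, k1, k2, k3, k4, k5⟩, hR, rfl⟩ := hU
  have hl : pr12 (bComp T U) = pr12 T := by
    ext ⟨a₁, a₂⟩
    constructor
    · rintro ⟨c₁, c₂, b₁, b₂, h, -⟩
      exact ⟨b₁, b₂, h⟩
    · rintro ⟨b₁, b₂, h⟩
      obtain ⟨c₁, c₂, h'⟩ : (b₁, b₂) ∈ pr12 U := hR ▸ ⟨a₁, a₂, h⟩
      exact ⟨c₁, c₂, b₁, b₂, h, h'⟩
  have hr : pr34 (bComp T U) = pr34 U := by
    ext ⟨c₁, c₂⟩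
    constructor
    · rintro ⟨a₁, a₂, b₁, b₂, -, h⟩
      exact ⟨b₁, b₂, h⟩
    · rintro ⟨b₁, b₂, h⟩
      obtain ⟨a₁, a₂, h'⟩ : (b₁, b₂) ∈ pr34 T := hR ▸ ⟨c₁, c₂, h⟩
      exact ⟨a₁, a₂, b₁, b₂, h', h⟩
  refine ⟨⟨h0.bComp k0, ?_, ?_, hl ▸ h3, hr ▸ k4, ?_⟩, hl, hr⟩
  · rintro a₁ a₂ c₁ c₂ a₁' a₂' ⟨b₁, b₂, h, k⟩ h₁ h₂
    exact ⟨b₁, b₂, h1 _ _ _ _ _ _ h h₁ h₂, k⟩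
  · rintro a₁ a₂ c₁ c₂ c₁' c₂' ⟨b₁, b₂, h, k⟩ h₁ h₂
    exact ⟨b₁, b₂, h, k2 _ _ _ _ _ _ k h₁ h₂⟩
  · rintro a₁ a₂ c₁ c₂ ⟨b₁, b₂, h, k⟩
    exact (h5 _ _ _ _ h).trans (k5 _ _ _ _ k)

theorem rcomp_btr_subset (T : Set (A × A × B × B)) (U : Set (B × B × C × C)) :
    rcomp (btr T) (btr U) ⊆ btr (bComp T U) := by
  rintro ⟨a, c⟩ ⟨b, h, k⟩
  exact ⟨b, b, h, k⟩

theorem IsBridgeLR.exists_btr_left (hT : IsBridgeLR S ρ σ L R T) (hρ : IsCongruence S ρ)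
    (hσ : IsCongruence S σ) (a : A) : ∃ b, (a, b) ∈ btr T := by
  obtain ⟨⟨-, -, h2, h3, -, h5⟩, -, -⟩ := hT
  obtain ⟨b₁, b₂, h⟩ := h3.1 (hρ.2.refl a)
  have hb := (h5 _ _ _ _ h).1 (hρ.2.refl a)
  exact ⟨b₁, h2 _ _ _ _ _ _ h (hσ.2.refl _) (hσ.2.symm hb)⟩

end Bridge

section Opt

variable {S : Signature} {A B : Type} [SAlg S A] [SAlg S B]
  {ρ L α : Set (A × A)} {σ R β : Set (B × B)} {T : Set (A × A × B × B)}

/-- `Opt(ρ,L)` contains the trace of every reflexive bridge from `(A,ρ,L)` to itself. -/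
theorem IsOptOf.btr_subset (hα : IsOptOf S ρ L α) {U : Set (A × A × A × A)}
    (hU : IsBridgeLR S ρ ρ L L U) (hrefl : ReflBridge U) : btr U ⊆ α := by
  obtain ⟨⟨V, hV, hVr, rfl⟩, hmax⟩ := hα
  have hsub := rcomp_btr_subset V U
  have heq := hmax (btr (bComp V U))
    ⟨_, hV.comp hU, fun a => hsub ⟨a, hVr a, hrefl a⟩, rfl⟩
    (fun p hp => hsub ⟨p.2, hp, hrefl p.2⟩)
  rw [← heq]
  exact fun p hp => hsub ⟨p.1, hVr p.1, hp⟩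

theorem IsBridgeLR.btr_conj_subset (hT : IsBridgeLR S ρ σ L R T) (hρ : IsCongruence S ρ)
    (hσ : IsCongruence S σ) (hα : IsOptOf S ρ L α) (hβ : IsOptOf S σ R β) {a a' : A} {b b' : B}
    (hab : (a, b) ∈ btr T) (hbb' : (b, b') ∈ β) (hab' : (a', b') ∈ btr T) : (a, a') ∈ α := by
  obtain ⟨⟨V, hV, hVr, rfl⟩, -⟩ := hβ
  refine hα.btr_subset (hT.comp (hV.comp hT.conv)) (fun x => ?_) ?_
  · obtain ⟨y, hy⟩ := hT.exists_btr_left hρ hσ x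
    exact ⟨y, y, hy, y, y, hVr y, hy⟩
  · exact ⟨b, b, hab, b', b', hbb', hab'⟩

theorem isCongruence_of_isOptOf (hα : IsOptOf S ρ L α) :
    IsCongruence S α := by
  have hα' := hα
  obtain ⟨⟨V, hV, hVr, rfl⟩, -⟩ := hα'
  refine ⟨hV.1.1.btr, hVr, fun {a b} h => ?_, fun {a b c} h h' => ?_⟩
  · exact hα.btr_subset hV.conv hVr h
  · exact hα.btr_subset (hV.comp hV) (fun a => ⟨a, a, hVr a, hVr a⟩) ⟨b, b, h, h'⟩

end Opt

/-- A relation that is total on both sides and compatible with two equivalences induces a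
bijection of the quotients. -/
theorem exists_quot_equiv {A B : Type} {α : Set (A × A)} {β : Set (B × B)} {G : Set (A × B)}
    (hα : Equivalence fun a b => (a, b) ∈ α) (hβ : Equivalence fun a b => (a, b) ∈ β)
    (hl : ∀ a, ∃ b, (a, b) ∈ G) (hr : ∀ b, ∃ a, (a, b) ∈ G)
    (hG : ∀ a a' b b', (a, a') ∈ α → (a, b) ∈ G → (b, b') ∈ β → (a', b') ∈ G)
    (hfun : ∀ a b b', (a, b) ∈ G → (a, b') ∈ G → (b, b') ∈ β)
    (hinj : ∀ a a' b, (a, b) ∈ G → (a', b) ∈ G → (a, a') ∈ α) :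
    ∃ γ : ConQuot α ≃ ConQuot β,
      ∀ a b, γ (ConQuot.mk α a) = ConQuot.mk β b ↔ (a, b) ∈ G := by
  choose g hg using hl
  let f : ConQuot α → ConQuot β := Quot.lift (fun a => ConQuot.mk β (g a)) fun a a' h =>
    Quot.sound (hfun a' _ _ (hG _ _ _ _ h (hg a) (hβ.refl _)) (hg a'))
  have hf : ∀ a b, f (ConQuot.mk α a) = ConQuot.mk β b ↔ (a, b) ∈ G := fun a b =>
    (hβ.quot_mk_eq_iff (g a) b).trans
      ⟨fun h => hG _ _ _ _ (hα.refl a) (hg a) h, fun h => hfun a _ _ (hg a) h⟩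
  refine ⟨Equiv.ofBijective f ⟨?_, ?_⟩, hf⟩
  · rintro ⟨a⟩ ⟨a'⟩ h
    exact Quot.sound (hinj a a' (g a') ((hf a (g a')).1 h) (hg a'))
  · rintro ⟨b⟩
    obtain ⟨a, ha⟩ := hr b
    exact ⟨ConQuot.mk α a, (hf a b).2 ha⟩

end Zhuk

open Zhuk

/-- the trace of a compact bridge induces an isomorphism
`A/Opt(ρ,L) ≅ B/Opt(σ,R)` whose graph on classes is `α ∘ tr(T) ∘ β`. -/
theorem stmt_3 {S : Zhuk.Signature} {A B : Type} [iA : Zhuk.SAlg S A] [iB : Zhuk.SAlg S B]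
    [Finite A] [Finite B]
    (ρ : Set (A × A)) (σ : Set (B × B))
    (hρ : Zhuk.ConStar S ρ) (hσ : Zhuk.ConStar S σ)
    (T : Set (A × A × B × B)) (hT : Zhuk.IsBridge S ρ σ T)
    (hcL : Zhuk.pr12 T ∈ Zhuk.Cov S ρ) (hcR : Zhuk.pr34 T ∈ Zhuk.Cov S σ)
    (α : Set (A × A)) (β : Set (B × B))
    (hα : Zhuk.IsOptOf S ρ (Zhuk.pr12 T) α) (hβ : Zhuk.IsOptOf S σ (Zhuk.pr34 T) β) :
    ∃ γ : Zhuk.ConQuot α ≃ Zhuk.ConQuot β,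
      Zhuk.IsHomI (Zhuk.quotAlg iA α) (Zhuk.quotAlg iB β) γ ∧
      ∀ (a : A) (b : B),
        (γ (Zhuk.ConQuot.mk α a) = Zhuk.ConQuot.mk β b ↔
          (a, b) ∈ Zhuk.rcomp α (Zhuk.rcomp (Zhuk.btr T) β)) := by
  have eα := isCongruence_of_isOptOf hα
  have eβ := isCongruence_of_isOptOf hβ
  have hT' : IsBridgeLR S ρ σ (pr12 T) (pr34 T) T := ⟨hT, rfl, rfl⟩
  have hG : IsSubuniverse S (rcomp α (rcomp (btr T) β)) :=
    eα.1.rcomp (hT.1.btr.rcomp eβ.1)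
  obtain ⟨γ, hγ⟩ := exists_quot_equiv eα.2 eβ.2 (G := rcomp α (rcomp (btr T) β))
    (fun a => by
      obtain ⟨b, hb⟩ := hT'.exists_btr_left hρ.1 hσ.1 a
      exact ⟨b, a, eα.2.refl a, b, hb, eβ.2.refl b⟩)
    (fun b => by
      obtain ⟨a, ha⟩ := hT'.conv.exists_btr_left hσ.1 hρ.1 b
      exact ⟨a, a, eα.2.refl a, b, ha, eβ.2.refl b⟩)
    (by
      rintro a a' b b' haa' ⟨c, hc, d, hd, hdb⟩ hbb'
      exact ⟨c, eα.2.trans (eα.2.symm haa') hc, d, hd, eβ.2.trans hdb hbb'⟩)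
    (by
      rintro a b b' ⟨c, hac, d, hcd, hdb⟩ ⟨c', hac', d', hcd', hdb'⟩
      have : (d, d') ∈ β := hT'.conv.btr_conj_subset hσ.1 hρ.1 hβ hα hcd
        (eα.2.trans (eα.2.symm hac) hac') hcd'
      exact eβ.2.trans (eβ.2.symm hdb) (eβ.2.trans this hdb'))
    (by
      rintro a a' b ⟨c, hac, d, hcd, hdb⟩ ⟨c', hac', d', hcd', hdb'⟩
      have : (c, c') ∈ α := hT'.btr_conj_subset hρ.1 hσ.1 hα hβ hcd
        (eβ.2.trans hdb (eβ.2.symm hdb')) hcd'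
      exact eα.2.trans hac (eα.2.trans this (eα.2.symm hac')))
  refine ⟨γ, fun o x => (hγ _ _).2 (hG o (fun i => (_, _)) fun i => (hγ _ _).1 ?_), hγ⟩
  exact (congrArg γ (Classical.choose_spec (Quot.exists_rep (x i)))).trans
    (Classical.choose_spec (Quot.exists_rep (γ (x i)))).symm
end

section
/- If A is a finite algebra and ρ ∈ Con(A) is irreducible, then ρ is meet-irreducible in Con(A), and its unique upper cover ρ⁺ is the transitive closure of ρ*. -/
namespace Zhuk

variable {S : Signature} {A : Type}

theorem saturated_iff {ρ R : Set (A × A)} (hρ : ∀ a, (a, a) ∈ ρ) :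
    Saturated ρ R ↔ ∀ a b c d, (a, b) ∈ ρ → (b, c) ∈ R → (c, d) ∈ ρ → (a, d) ∈ R := by
  constructor
  · intro h a b c d hab hbc hcd
    rw [← h]
    exact ⟨b, hab, c, hbc, hcd⟩
  · intro h
    refine Set.Subset.antisymm ?_ ?_
    · rintro ⟨a, d⟩ ⟨b, hab, c, hbc, hcd⟩
      exact h a b c d hab hbc hcd
    · rintro ⟨a, d⟩ had
      exact ⟨a, hρ a, d, had, hρ d⟩

theorem rinv_rinv (R : Set (A × A)) : rinv (rinv R) = R := rfl

theorem rinv_mono {R T : Set (A × A)} (h : R ⊆ T) : rinv R ⊆ rinv T :=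
  fun _ hp => h hp

theorem rinv_ssubset {R T : Set (A × A)} (h : R ⊂ T) : rinv R ⊂ rinv T :=
  ⟨rinv_mono h.1, fun h' => h.2 (rinv_mono h')⟩

theorem transCl_subset_of_transitive {R θ : Set (A × A)} (h : R ⊆ θ)
    (hθ : ∀ {a b c}, (a, b) ∈ θ → (b, c) ∈ θ → (a, c) ∈ θ) : transCl R ⊆ θ := by
  rintro ⟨a, b⟩ hab
  replace hab : Relation.TransGen (fun a b => (a, b) ∈ R) a b := hab
  induction hab with
  | single h₁ => exact h h₁
  | tail _ h₁ ih => exact hθ ih (h h₁)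

variable [SAlg S A]

theorem IsCongruence.rinv_eq {ρ : Set (A × A)} (hρ : IsCongruence S ρ) : rinv ρ = ρ :=
  Set.ext fun _ => ⟨fun h => hρ.2.symm h, fun h => hρ.2.symm h⟩

theorem IsSubuniverse.rinv {R : Set (A × A)} (hR : IsSubuniverse S R) :
    IsSubuniverse S (rinv R) :=
  fun o x hx => hR o (fun i => (x i).swap) hx

theorem IsCongruence.saturated_of_subset {ρ θ : Set (A × A)} (hρ : IsCongruence S ρ)
    (hθ : IsCongruence S θ) (h : ρ ⊆ θ) : Saturated ρ θ :=
  (saturated_iff hρ.2.refl).2 fun _ _ _ _ hab hbc hcd =>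
    hθ.2.trans (hθ.2.trans (h hab) hbc) (h hcd)

theorem IsCongruence.saturated_rinv {ρ R : Set (A × A)} (hρ : IsCongruence S ρ)
    (hR : Saturated ρ R) : Saturated ρ (rinv R) := by
  rw [saturated_iff hρ.2.refl] at hR ⊢
  exact fun a b c d hab hbc hcd =>
    hR d c b a (hρ.2.symm hcd) hbc (hρ.2.symm hab)

theorem IsCongruence.rinv_mem_cov {ρ R : Set (A × A)} (hρ : IsCongruence S ρ)
    (hR : R ∈ Cov S ρ) : rinv R ∈ Cov S ρ := by
  obtain ⟨hsub, hsat, hlt, hmin⟩ := hR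
  refine ⟨hsub.rinv, hρ.saturated_rinv hsat, ?_, fun L hL hLs hLlt hLle => ?_⟩
  · simpa only [hρ.rinv_eq] using rinv_ssubset hlt
  · have h := hmin (rinv L) hL.rinv (hρ.saturated_rinv hLs)
      (by simpa only [hρ.rinv_eq] using rinv_ssubset hLlt) (rinv_mono hLle)
    rw [← h, rinv_rinv]

theorem exists_mem_cov_subset [Finite A] {ρ θ : Set (A × A)} (hθ : IsSubuniverse S θ)
    (hsat : Saturated ρ θ) (hlt : ρ ⊂ θ) : ∃ L ∈ Cov S ρ, L ⊆ θ := by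
  obtain ⟨L, hLθ, hL⟩ := (Set.toFinite
    {L : Set (A × A) | IsSubuniverse S L ∧ Saturated ρ L ∧ ρ ⊂ L}).exists_le_minimal
    ⟨hθ, hsat, hlt⟩
  exact ⟨L, ⟨hL.1.1, hL.1.2.1, hL.1.2.2, fun L' h₁ h₂ h₃ h₄ =>
    Set.Subset.antisymm h₄ (hL.2 ⟨h₁, h₂, h₃⟩ h₄)⟩, hLθ⟩

/-- The transitive closure of a reflexive subuniverse of `A²` is a subuniverse. -/
theorem IsSubuniverse.transCl {R : Set (A × A)} (hR : IsSubuniverse S R)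
    (hrefl : ∀ a, (a, a) ∈ R) : IsSubuniverse S (transCl R) := by
  classical
  intro o x hx
  let r : A → A → Prop := fun a b => (a, b) ∈ R
  have hupdate (z : Fin (S.arity o) → A) (i : Fin (S.arity o)) {a b : A}
      (hab : Relation.TransGen r a b) :
      Relation.TransGen r (SAlg.interp o (Function.update z i a))
        (SAlg.interp o (Function.update z i b)) := by
    refine hab.lift (fun c => SAlg.interp o (Function.update z i c)) fun c d hcd => ?_
    refine hR o (fun j => (Function.update z i c j, Function.update z i d j)) fun j => ?_
    by_cases hj : j = i
    · subst hj
      simpa using hcd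
    · simpa [hj] using hrefl (z j)
  have hpiecewise (s : Finset (Fin (S.arity o))) :
      Relation.TransGen r (SAlg.interp o fun i => (x i).1)
        (SAlg.interp o (s.piecewise (fun i => (x i).2) fun i => (x i).1)) := by
    induction s using Finset.induction_on with
    | empty =>
      rw [Finset.piecewise_empty]
      exact .single (hrefl _)
    | insert i s hi ih =>
      refine ih.trans ?_
      rw [Finset.piecewise_insert]
      have h := hupdate (s.piecewise (fun i => (x i).2) fun i => (x i).1) i (hx i)
      rwa [Function.update_eq_self_iff.2 (by simp [hi])] at h
  have h := hpiecewise Finset.univ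
  rwa [Finset.piecewise_univ] at h

theorem IsSubuniverse.isCongruence_transCl {R : Set (A × A)} (hR : IsSubuniverse S R)
    (hrefl : ∀ a, (a, a) ∈ R) (hsymm : ∀ {a b}, (a, b) ∈ R → (b, a) ∈ R) :
    IsCongruence S (Zhuk.transCl R) := by
  refine ⟨hR.transCl hrefl, fun a => .single (hrefl a), fun hab => ?_,
    fun hab hbc => Relation.TransGen.trans hab hbc⟩
  exact Relation.TransGen.mono (fun _ _ h => hsymm h) _ _ (Relation.TransGen.swap _ _ hab)

end Zhuk

/-- an irreducible congruence of a finite algebra is meet-irreducible, and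
its unique upper cover `ρ⁺` is the transitive closure of `ρ*`. -/
theorem stmt_5 {S : Zhuk.Signature} {A : Type} [Zhuk.SAlg S A] [Finite A]
    (ρ ρstar : Set (A × A)) (hρ : Zhuk.ConStar S ρ)
    (hirr : Zhuk.Cov S ρ = {ρstar}) :
    ∃ ρplus : Set (A × A),
      Zhuk.MeetIrredWith S ρ ρplus ∧ ρplus = Zhuk.transCl ρstar := by
  have hcov : ρstar ∈ Zhuk.Cov S ρ := hirr ▸ rfl
  have hinv : Zhuk.rinv ρstar = ρstar := by
    have h := hρ.1.rinv_mem_cov hcov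
    rwa [hirr] at h
  have hlt : ρ ⊂ ρstar := hcov.2.2.1
  have hsymm {a b : A} (hab : (a, b) ∈ ρstar) : (b, a) ∈ ρstar := by
    rw [← hinv]
    exact hab
  refine ⟨Zhuk.transCl ρstar, ⟨hρ.1, hρ.2,
    hcov.1.isCongruence_transCl (fun a => hlt.1 (hρ.1.2.refl a)) hsymm,
    hlt.trans_subset fun _ hp => .single hp, fun θ hθ hρθ => ?_⟩, rfl⟩
  obtain ⟨L, hL, hLθ⟩ := Zhuk.exists_mem_cov_subset hθ.1
    (hρ.1.saturated_of_subset hθ hρθ.1) hρθ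
  rw [hirr] at hL
  obtain rfl : L = ρstar := hL
  exact Zhuk.transCl_subset_of_transitive hLθ hθ.2.trans
end
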